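/- arXiv:1605.09429 — 3 statements merged into one kernel-verified Lean document; each statement's English description precedes it below -/
import Mathlib

section
/- Let d ≥ 3 be an integer, let {e₁, …, e_d} be the standard orthonormal basis of ℝ^d, and let u₁, …, u_d be the columns of the matrix U = (2/d)·J − I_d, where J is the d×d all-ones matrix. Then the combined family of 2d unit vectors {e₁, …, e_d, u₁, …, u_d} is a tight frame for ℝ^d with frame bound 2 (i.e., Σᵢ ⟨z, eᵢ⟩eᵢ + Σᵢ ⟨z, uᵢ⟩uᵢ = 2z for all z ∈ ℝ^d), and the absolute value of the inner product of any two distinct vectors in this family belongs to the set {0, 2/d, 1 − 2/d}. -/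
open scoped RealInnerProductSpace

/-- An orthonormal family with as many members as the dimension reproduces every vector. -/
theorem Orthonormal.sum_inner_smul_eq_self {ι E : Type*} [Fintype ι] [NormedAddCommGroup E]
    [InnerProductSpace ℝ E] [FiniteDimensional ℝ E] {v : ι → E} (hv : Orthonormal ℝ v)
    (hcard : Module.finrank ℝ E = Fintype.card ι) (z : E) :
    ∑ i, ⟪z, v i⟫ • v i = z := by
  obtain ⟨b, hb⟩ := Orthonormal.exists_orthonormalBasis_extension_of_card_eq (𝕜 := ℝ) hcard
    (v := v) (s := Set.univ) (hv.comp _ Subtype.val_injective)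
  have h := b.sum_repr' z
  simp only [fun i => hb i (Set.mem_univ i)] at h
  simpa only [real_inner_comm] using h

/-- The columns of `(2/d)·J - I` are orthonormal. -/
theorem orthonormal_of_apply_eq_two_div_sub {d : ℕ} (hd : d ≠ 0)
    {u : Fin d → EuclideanSpace ℝ (Fin d)}
    (hu : ∀ i j, u i j = 2 / (d : ℝ) - if j = i then 1 else 0) : Orthonormal ℝ u := by
  have hd' : (d : ℝ) ≠ 0 := Nat.cast_ne_zero.mpr hd
  rw [orthonormal_iff_ite]
  intro i j
  simp only [PiLp.inner_apply, hu, RCLike.inner_apply, conj_trivial, sub_mul, mul_sub,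
    Finset.sum_sub_distrib, Finset.sum_const, Finset.card_univ, Fintype.card_fin, nsmul_eq_mul,
    mul_ite, ite_mul, mul_one, one_mul, mul_zero, zero_mul, Finset.sum_ite_eq',
    Finset.mem_univ, if_true]
  split_ifs <;> field_simp <;> ring

/-- For `d ≥ 3`, the standard basis of `ℝ^d` together with the columns of
`U = (2/d)·J - I` forms a family of `2d` unit vectors which is a tight frame with frame
bound `2`, and the absolute values of inner products between distinct members lie in
`{0, 2/d, 1 - 2/d}`. -/
theorem standard_basis_union_columns_tight_frame (d : ℕ) (hd : 3 ≤ d)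
    (e : Fin d → EuclideanSpace ℝ (Fin d)) (he : ∀ i, e i = EuclideanSpace.single i 1)
    (u : Fin d → EuclideanSpace ℝ (Fin d))
    (hu : ∀ i j, u i j = 2 / (d : ℝ) - if j = i then 1 else 0)
    (g : Fin d ⊕ Fin d → EuclideanSpace ℝ (Fin d)) (hg : g = Sum.elim e u) :
    (∀ a, ‖g a‖ = 1) ∧
    (∀ z : EuclideanSpace ℝ (Fin d),
      (∑ i, ⟪z, e i⟫ • e i) + (∑ i, ⟪z, u i⟫ • u i) = (2 : ℝ) • z) ∧
    (∀ a b, a ≠ b → |⟪g a, g b⟫| ∈ ({0, 2 / (d : ℝ), 1 - 2 / (d : ℝ)} : Set ℝ)) := by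
  subst hg
  have hd0 : d ≠ 0 := by omega
  have hu_orth : Orthonormal ℝ u := orthonormal_of_apply_eq_two_div_sub hd0 hu
  have he_orth : Orthonormal ℝ e := by
    rw [funext he]
    exact EuclideanSpace.orthonormal_single
  have hcross : ∀ i j, |⟪e i, u j⟫| ∈ ({0, 2 / (d : ℝ), 1 - 2 / (d : ℝ)} : Set ℝ) := by
    intro i j
    have hle : 2 / (d : ℝ) ≤ 1 := by
      rw [div_le_one (by positivity)]
      exact_mod_cast (by omega : 2 ≤ d)
    have hinner : ⟪e i, u j⟫ = 2 / (d : ℝ) - if i = j then 1 else 0 := by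
      rw [he, EuclideanSpace.inner_single_left, hu]
      simp
    rw [hinner]
    split_ifs
    · rw [abs_of_nonpos (by linarith), neg_sub]
      simp
    · rw [sub_zero, abs_of_nonneg (by positivity)]
      simp
  refine ⟨?_, fun z => ?_, ?_⟩
  · rintro (i | i)
    exacts [he_orth.1 i, hu_orth.1 i]
  · rw [he_orth.sum_inner_smul_eq_self (by simp), hu_orth.sum_inner_smul_eq_self (by simp),
      two_smul]
  · rintro (i | i) (j | j) hij
    · left
      simpa using he_orth.2 (fun h => hij (congrArg Sum.inl h))
    · exact hcross i j
    · simpa only [Sum.elim_inl, Sum.elim_inr, real_inner_comm] using hcross j i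
    · left
      simpa using hu_orth.2 (fun h => hij (congrArg Sum.inr h))
end

section
/- Let d, k be positive integers with k < d+1, set d' = C(d+1, k), and let Λ₁, …, Λ_{d'} enumerate the k-element subsets of {1, …, d+1}. Let f₁, …, f_{d+1} be unit vectors in ℝ^d with ⟨f_i, f_j⟩ = −1/d for all i ≠ j, and define g_i = (Σ_{j∈Λ_i} f_j)/‖Σ_{j∈Λ_i} f_j‖ for 1 ≤ i ≤ d'. Then {g_i}_{i=1}^{d'} is a unit-normed tight frame for ℝ^d with frame bound d'/d, i.e., Σ_{i=1}^{d'} ⟨z, g_i⟩ g_i = (d'/d)·z for every z ∈ ℝ^d. -/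
open scoped RealInnerProductSpace

/-- The number of `k`-subsets containing `i` but not `j`. -/
lemma card_filter_powersetCard_mem_notMem {α : Type*} [Fintype α] [DecidableEq α] {k : ℕ}
    (hk : 0 < k) {i j : α} (hij : i ≠ j) :
    ((Finset.powersetCard k (Finset.univ : Finset α)).filter
      (fun s => i ∈ s ∧ j ∉ s)).card = (Fintype.card α - 2).choose (k - 1) := by
  have hcard : (Finset.univ \ {i, j} : Finset α).card = Fintype.card α - 2 := by
    rw [Finset.card_sdiff_of_subset (Finset.subset_univ _), Finset.card_pair hij,
      Finset.card_univ]
  rw [← hcard, ← Finset.card_powersetCard]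
  refine Finset.card_nbij' (fun s => s.erase i) (fun t => insert i t) ?_ ?_ ?_ ?_
  · intro s hs
    simp only [Finset.coe_filter, Finset.mem_powersetCard, Set.mem_ofPred_eq] at hs
    simp only [Finset.mem_coe, Finset.mem_powersetCard]
    refine ⟨fun x hx => ?_, by rw [Finset.card_erase_of_mem hs.2.1, hs.1.2]⟩
    have := hs.2.2
    simp only [Finset.mem_erase] at hx
    simp only [Finset.mem_sdiff, Finset.mem_univ, Finset.mem_insert, Finset.mem_singleton]
    grind
  · intro t ht
    simp only [Finset.mem_coe, Finset.mem_powersetCard] at ht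
    have hi : i ∉ t := fun h => by simpa using ht.1 h
    have hj : j ∉ t := fun h => by simpa using ht.1 h
    simp only [Finset.coe_filter, Finset.mem_powersetCard, Set.mem_ofPred_eq]
    refine ⟨⟨Finset.subset_univ _, ?_⟩, Finset.mem_insert_self _ _, ?_⟩
    · rw [Finset.card_insert_of_notMem hi, ht.2]; omega
    · simp [hj, hij.symm]
  · intro s hs
    simp only [Finset.coe_filter, Set.mem_ofPred_eq] at hs
    exact Finset.insert_erase hs.2.1
  · intro t ht
    simp only [Finset.mem_coe, Finset.mem_powersetCard] at ht
    exact Finset.erase_insert fun h => by simpa using ht.1 h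

/-- For vectors summing to zero, the sum over the `k`-subsets containing `i` of the subset sums
is a multiple of the `i`-th vector. -/
lemma sum_filter_mem_powersetCard_sum {α E : Type*} [Fintype α] [DecidableEq α]
    [AddCommGroup E] {k : ℕ} (hk : 0 < k) (f : α → E) (hf : ∑ j, f j = 0) (i : α) :
    ∑ s ∈ (Finset.powersetCard k (Finset.univ : Finset α)).filter (fun s => i ∈ s),
      ∑ j ∈ s, f j = (Fintype.card α - 2).choose (k - 1) • f i := by
  have hcompl (s : Finset α) : ∑ j ∈ s, f j = -∑ j, if j ∉ s then f j else 0 := by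
    rw [← Finset.sum_filter, eq_neg_iff_add_eq_zero, ← hf,
      ← Finset.sum_filter_add_sum_filter_not Finset.univ (· ∈ s)]
    simp
  have hcount (j : α) :
      ∑ s ∈ (Finset.powersetCard k (Finset.univ : Finset α)).filter (fun s => i ∈ s),
        (if j ∉ s then f j else 0)
      = (Fintype.card α - 2).choose (k - 1) • (f j - if j = i then f i else 0) := by
    rw [← Finset.sum_filter, Finset.sum_const, Finset.filter_filter]
    by_cases hij : j = i
    · subst hij; simp
    · rw [card_filter_powersetCard_mem_notMem hk (Ne.symm hij)]; simp [hij]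
  rw [Finset.sum_congr rfl fun s _ => hcompl s, Finset.sum_neg_distrib, Finset.sum_comm,
    Finset.sum_congr rfl fun j _ => hcount j, ← Finset.smul_sum, Finset.sum_sub_distrib, hf]
  simp

section Simplex

variable {E : Type*} [NormedAddCommGroup E] [InnerProductSpace ℝ E] {d : ℕ}
  {f : Fin (d + 1) → E}

lemma inner_simplex (hd : 0 < d) (hnorm : ∀ i, ‖f i‖ = 1)
    (hangle : ∀ i j, i ≠ j → ⟪f i, f j⟫ = -1 / (d : ℝ)) (i j : Fin (d + 1)) :
    ⟪f i, f j⟫ = (if i = j then ((d : ℝ) + 1) / d else 0) - 1 / d := by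
  have : (d : ℝ) ≠ 0 := by positivity
  by_cases h : i = j
  · subst h
    rw [real_inner_self_eq_norm_sq, hnorm]
    simp only [if_true]
    field_simp
    ring
  · rw [hangle i j h]; simp [h, neg_div]

lemma norm_sq_sum_simplex (hd : 0 < d) (hnorm : ∀ i, ‖f i‖ = 1)
    (hangle : ∀ i j, i ≠ j → ⟪f i, f j⟫ = -1 / (d : ℝ)) (s : Finset (Fin (d + 1))) :
    ‖∑ j ∈ s, f j‖ ^ 2 = (s.card : ℝ) * (d + 1 - s.card) / d := by
  rw [← real_inner_self_eq_norm_sq, sum_inner]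
  simp only [inner_sum, inner_simplex hd hnorm hangle, Finset.sum_sub_distrib,
    Finset.sum_ite_eq, Finset.sum_ite_mem, Finset.inter_self, Finset.sum_const, nsmul_eq_mul]
  ring

lemma sum_simplex_eq_zero (hd : 0 < d) (hnorm : ∀ i, ‖f i‖ = 1)
    (hangle : ∀ i j, i ≠ j → ⟪f i, f j⟫ = -1 / (d : ℝ)) : ∑ j, f j = 0 := by
  have h := norm_sq_sum_simplex hd hnorm hangle Finset.univ
  simpa using h

lemma span_simplex_eq_top (hd : 0 < d) (hE : Module.finrank ℝ E = d)
    (hnorm : ∀ i, ‖f i‖ = 1)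
    (hangle : ∀ i j, i ≠ j → ⟪f i, f j⟫ = -1 / (d : ℝ)) :
    Submodule.span ℝ (Set.range f) = ⊤ := by
  have hd' : (d : ℝ) ≠ 0 := by positivity
  have hli : LinearIndependent ℝ (fun i : Fin d => f i.castSucc) := by
    rw [Fintype.linearIndependent_iff]
    intro c hc j
    have hinner (l : Fin (d + 1)) : ∑ i : Fin d, c i * ⟪f i.castSucc, f l⟫ = 0 := by
      simpa [sum_inner, real_inner_smul_left] using congrArg (fun v => ⟪v, f l⟫) hc
    have hlast := hinner (Fin.last d)
    have hj := hinner j.castSucc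
    simp only [inner_simplex hd hnorm hangle, mul_sub, Finset.sum_sub_distrib,
      ← Finset.sum_mul, (Fin.castSucc_lt_last _).ne, Fin.castSucc_inj, if_false, mul_zero,
      Finset.sum_const_zero, mul_ite, Finset.sum_ite_eq', Finset.mem_univ, if_true]
      at hlast hj
    have : c j * (((d : ℝ) + 1) / d) = 0 := by linarith
    have hpos : ((d : ℝ) + 1) / d ≠ 0 := by positivity
    exact (mul_eq_zero.mp this).resolve_right hpos
  have : Nonempty (Fin d) := ⟨⟨0, hd⟩⟩
  have htop := hli.span_eq_top_of_card_eq_finrank (by simp [hE])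
  rw [eq_top_iff, ← htop]
  apply Submodule.span_mono
  rintro _ ⟨i, rfl⟩
  exact ⟨_, rfl⟩

/-- The vertices of a regular simplex form a tight frame. -/
lemma sum_inner_smul_simplex (hd : 0 < d) (hE : Module.finrank ℝ E = d)
    (hnorm : ∀ i, ‖f i‖ = 1)
    (hangle : ∀ i j, i ≠ j → ⟪f i, f j⟫ = -1 / (d : ℝ)) (z : E) :
    ∑ i, ⟪z, f i⟫ • f i = (((d : ℝ) + 1) / d) • z := by
  have hz : z ∈ Submodule.span ℝ (Set.range f) := by
    rw [span_simplex_eq_top hd hE hnorm hangle]; trivial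
  induction hz using Submodule.span_induction with
  | mem x hx =>
    obtain ⟨j, rfl⟩ := hx
    simp only [inner_simplex hd hnorm hangle, sub_smul, Finset.sum_sub_distrib,
      ← Finset.smul_sum, sum_simplex_eq_zero hd hnorm hangle, ite_smul, zero_smul,
      Finset.sum_ite_eq, Finset.mem_univ, if_true, smul_zero, sub_zero]
  | zero => simp
  | add x y _ _ hx hy => simp only [inner_add_left, add_smul, Finset.sum_add_distrib, hx, hy,
      smul_add]
  | smul a x _ hx =>
    simp only [real_inner_smul_left, mul_smul, ← Finset.smul_sum, hx]
    exact smul_comm _ _ _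

end Simplex

lemma choose_succ_mul_mul {d k : ℕ} (hd : 0 < d) (hk : 0 < k) (hkd : k < d + 1) :
    ((d + 1).choose k : ℝ) * k * (d + 1 - k) = (d + 1) * d * (d - 1).choose (k - 1) := by
  obtain ⟨e, rfl⟩ := Nat.exists_eq_succ_of_ne_zero hd.ne'
  obtain ⟨l, rfl⟩ := Nat.exists_eq_succ_of_ne_zero hk.ne'
  have h₁ := Nat.add_one_mul_choose_eq (e + 1) l
  have h₂ := Nat.choose_mul_succ_eq e l
  have h₁' : ((e : ℝ) + 1 + 1) * (e + 1).choose l = (e + 1 + 1).choose (l + 1) * (l + 1) := by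
    exact_mod_cast h₁
  have h₂' : (e.choose l : ℝ) * (e + 1) = (e + 1).choose l * (e + 1 - l) := by
    have hle : l ≤ e + 1 := by omega
    have := congrArg (Nat.cast (R := ℝ)) h₂
    push_cast [Nat.cast_sub hle] at this
    exact this
  simp only [Nat.succ_eq_add_one, Nat.add_sub_cancel]
  push_cast
  linear_combination (-((e : ℝ) + 1 - l)) * h₁' - ((e : ℝ) + 1 + 1) * h₂'

/-- If `f₁, …, f_{d+1}` are unit vectors in `ℝ^d` with pairwise inner products `-1/d`, the
normalized sums `g_Λ` over the `k`-element subsets `Λ` of `{1, …, d+1}` form a unit-normed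
tight frame of `d' = C(d+1,k)` vectors for `ℝ^d` with frame bound `d'/d`. -/
theorem normalized_subset_sums_tight_frame (d k : ℕ) (hd : 0 < d) (hk : 0 < k)
    (hkd : k < d + 1)
    (f : Fin (d + 1) → EuclideanSpace ℝ (Fin d))
    (hnorm : ∀ i, ‖f i‖ = 1)
    (hangle : ∀ i j, i ≠ j → ⟪f i, f j⟫ = -1 / (d : ℝ))
    (g : {s : Finset (Fin (d + 1)) // s.card = k} → EuclideanSpace ℝ (Fin d))
    (hg : ∀ s, g s = (‖∑ j ∈ s.1, f j‖)⁻¹ • ∑ j ∈ s.1, f j) :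
    (∀ s, ‖g s‖ = 1) ∧
    (∀ z : EuclideanSpace ℝ (Fin d),
      ∑ s : {s : Finset (Fin (d + 1)) // s.card = k}, ⟪z, g s⟫ • g s
        = ((Nat.choose (d + 1) k : ℝ) / (d : ℝ)) • z) := by
  have hsq (s : {s : Finset (Fin (d + 1)) // s.card = k}) :
      ‖∑ j ∈ s.1, f j‖ ^ 2 = (k : ℝ) * (d + 1 - k) / d := by
    rw [norm_sq_sum_simplex hd hnorm hangle, s.2]
  have hdR : (0 : ℝ) < d := by exact_mod_cast hd
  have hkR : (0 : ℝ) < k := by exact_mod_cast hk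
  have hkdR : (0 : ℝ) < d + 1 - k := by
    have : (k : ℝ) < d + 1 := by exact_mod_cast hkd
    linarith
  refine ⟨fun s => ?_, fun z => ?_⟩
  · have hne : ‖∑ j ∈ s.1, f j‖ ≠ 0 := by
      intro h
      have hs := hsq s
      rw [h] at hs
      have : 0 < (k : ℝ) * (d + 1 - k) / d := by positivity
      simp only [ne_eq, OfNat.ofNat_ne_zero, not_false_eq_true, zero_pow] at hs
      linarith
    rw [hg, norm_smul, norm_inv, norm_norm, inv_mul_cancel₀ hne]
  · have hterm (s : {s : Finset (Fin (d + 1)) // s.card = k}) : ⟪z, g s⟫ • g s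
        = ((k : ℝ) * (d + 1 - k) / d)⁻¹ • (⟪z, ∑ j ∈ s.1, f j⟫ • ∑ j ∈ s.1, f j) := by
      rw [hg, real_inner_smul_right, smul_smul, smul_smul, ← hsq s]
      congr 1
      ring
    have hsum : ∑ s : {s : Finset (Fin (d + 1)) // s.card = k},
        ⟪z, ∑ j ∈ s.1, f j⟫ • ∑ j ∈ s.1, f j
        = ((d - 1).choose (k - 1) : ℝ) • ∑ i, ⟪z, f i⟫ • f i := by
      rw [← Finset.sum_subtype (Finset.powersetCard k Finset.univ)
        (fun s => by simp [Finset.mem_powersetCard])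
        (fun s => ⟪z, ∑ j ∈ s, f j⟫ • ∑ j ∈ s, f j)]
      have hexpand (s : Finset (Fin (d + 1))) : ⟪z, ∑ j ∈ s, f j⟫ • ∑ j ∈ s, f j
          = ∑ i, if i ∈ s then ⟪z, f i⟫ • ∑ j ∈ s, f j else 0 := by
        rw [inner_sum, Finset.sum_smul, Finset.sum_ite_mem, Finset.univ_inter]
      rw [Finset.sum_congr rfl fun s _ => hexpand s, Finset.sum_comm, Finset.smul_sum]
      refine Finset.sum_congr rfl fun i _ => ?_
      rw [← Finset.sum_filter, ← Finset.smul_sum, sum_filter_mem_powersetCard_sum hk f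
        (sum_simplex_eq_zero hd hnorm hangle), Fintype.card_fin, smul_comm,
        ← Nat.cast_smul_eq_nsmul ℝ]
      rfl
    rw [Finset.sum_congr rfl fun s _ => hterm s, ← Finset.smul_sum, hsum,
      sum_inner_smul_simplex hd (by simp) hnorm hangle, smul_smul, smul_smul]
    congr 1
    have hchoose := choose_succ_mul_mul hd hk hkd
    field_simp
    linear_combination -hchoose
end

section
/- Let d, k be positive integers with k < d+1, set d' = C(d+1, k), and let Λ₁, …, Λ_{d'} enumerate the k-element subsets of {1, …, d+1}. Let f₁, …, f_{d+1} be unit vectors in ℝ^d with ⟨f_i, f_j⟩ = −1/d for all i ≠ j, and define g_i = (Σ_{j∈Λ_i} f_j)/‖Σ_{j∈Λ_i} f_j‖. Then the set of values {⟨g_i, g_j⟩ : 1 ≤ i, j ≤ d', i ≠ j} is contained in the k-element set {(l(d+1) − k²)/(k(d+1−k)) : l = 0, 1, …, k−1}; in particular the inner products between distinct vectors g_i take at most k distinct values. -/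
open scoped RealInnerProductSpace

/-- Inner products of subset sums of unit vectors with constant pairwise inner product `c`. -/
theorem inner_sum_sum_of_equiangular {ι E : Type*} [DecidableEq ι] [NormedAddCommGroup E]
    [InnerProductSpace ℝ E] {f : ι → E} {c : ℝ} (hnorm : ∀ i, ‖f i‖ = 1)
    (hangle : ∀ i j, i ≠ j → ⟪f i, f j⟫ = c) (s t : Finset ι) :
    ⟪∑ i ∈ s, f i, ∑ j ∈ t, f j⟫ = ((s ∩ t).card : ℝ) * (1 - c) + s.card * t.card * c := by
  have h (i j : ι) : ⟪f i, f j⟫ = (if i = j then 1 - c else 0) + c := by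
    split_ifs with hij
    · subst hij
      simp [hnorm]
    · rw [hangle i j hij, zero_add]
  simp only [sum_inner, inner_sum, h, Finset.sum_add_distrib, Finset.sum_ite_eq',
    Finset.sum_ite_mem, Finset.sum_const, nsmul_eq_mul, Finset.inter_comm t s]
  ring

/-- Two distinct finite sets of the same size meet in strictly fewer elements. -/
theorem Finset.card_inter_lt_of_card_eq {ι : Type*} [DecidableEq ι] {s t : Finset ι}
    (hcard : s.card = t.card) (hne : s ≠ t) : (s ∩ t).card < s.card := by
  refine Finset.card_lt_card (Finset.inter_subset_left.ssubset_of_ne fun h => hne ?_)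
  exact Finset.eq_of_subset_of_card_le (Finset.inter_eq_left.mp h) hcard.ge

/-- If `f₁, …, f_{d+1}` are unit vectors in `ℝ^d` with pairwise inner products `-1/d`, the
inner products between distinct normalized `k`-subset sums `g_Λ` all belong to the set
`{(l(d+1) - k²)/(k(d+1-k)) : 0 ≤ l ≤ k-1}`; in particular they take at most `k` distinct
values. -/
theorem normalized_subset_sums_k_angle (d k : ℕ) (hd : 0 < d) (hk : 0 < k)
    (hkd : k < d + 1)
    (f : Fin (d + 1) → EuclideanSpace ℝ (Fin d))
    (hnorm : ∀ i, ‖f i‖ = 1)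
    (hangle : ∀ i j, i ≠ j → ⟪f i, f j⟫ = -1 / (d : ℝ))
    (g : {s : Finset (Fin (d + 1)) // s.card = k} → EuclideanSpace ℝ (Fin d))
    (hg : ∀ s, g s = (‖∑ j ∈ s.1, f j‖)⁻¹ • ∑ j ∈ s.1, f j) :
    ∀ s t : {s : Finset (Fin (d + 1)) // s.card = k}, s ≠ t →
      ∃ l : ℕ, l < k ∧
        ⟪g s, g t⟫ = ((l : ℝ) * ((d : ℝ) + 1) - (k : ℝ) ^ 2)
          / ((k : ℝ) * ((d : ℝ) + 1 - (k : ℝ))) := by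
  rintro ⟨s, hs⟩ ⟨t, ht⟩ hst
  have hne : s ≠ t := fun h => hst (Subtype.ext h)
  have hd' : (0 : ℝ) < d := by exact_mod_cast hd
  have hk' : (0 : ℝ) < k := by exact_mod_cast hk
  have hkd' : (0 : ℝ) < d + 1 - k := sub_pos.mpr (by exact_mod_cast hkd)
  have hsq (u : Finset (Fin (d + 1))) (hu : u.card = k) :
      ‖∑ j ∈ u, f j‖ ^ 2 = k * (d + 1 - k) / d := by
    rw [← real_inner_self_eq_norm_sq, inner_sum_sum_of_equiangular hnorm hangle,
      Finset.inter_self, hu]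
    field_simp
    ring
  have hnorm_eq : ‖∑ j ∈ s, f j‖ = ‖∑ j ∈ t, f j‖ :=
    (sq_eq_sq₀ (norm_nonneg _) (norm_nonneg _)).mp ((hsq s hs).trans (hsq t ht).symm)
  refine ⟨(s ∩ t).card, hs ▸ Finset.card_inter_lt_of_card_eq (hs.trans ht.symm) hne, ?_⟩
  rw [hg, hg, real_inner_smul_left, real_inner_smul_right, hnorm_eq, ← mul_assoc, ← mul_inv,
    ← sq, hsq t ht, inner_sum_sum_of_equiangular hnorm hangle, hs, ht]
  field_simp
  ring
end
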